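/- arXiv:1803.05649 — 7 statements merged into one kernel-verified Lean document; each statement's English description precedes it below -/
import Mathlib

section
/- Invertibility of Sylvester normalizing flows (general case): let M ≤ D, let Q be a real D×M matrix with orthonormal columns (Qᵀ Q = I_M), let R and R̃ be M×M upper triangular real matrices with R̃ invertible, let b ∈ ℝ^M, and let h : ℝ → ℝ be continuously differentiable with derivative h' satisfying 0 < h'(x) ≤ C for all x ∈ ℝ and some constant C > 0. If the diagonal entries satisfy C · R_{ii} · R̃_{ii} > -1 for all i = 1,…,M, then the map φ : ℝ^D → ℝ^D given by φ(z) = z + Q R h(R̃ Qᵀ z + b) (with h applied componentwise) is a bijection of ℝ^D. -/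
open Matrix

lemma scalar_bij (h : ℝ → ℝ) (C t : ℝ) (hh : ContDiff ℝ 1 h)
    (hh' : ∀ x : ℝ, 0 < deriv h x ∧ deriv h x ≤ C) (ht : C * t > -1) :
    Function.Bijective (fun x : ℝ => x + t * h x) := by
  have hd : Differentiable ℝ h := hh.differentiable (by norm_num)
  obtain ⟨c, hc, hct⟩ : ∃ c : ℝ, 0 < c ∧ ∀ x, c ≤ 1 + t * deriv h x := by
    rcases le_total 0 t with h0 | h0
    · exact ⟨1, one_pos, fun x => by nlinarith [mul_nonneg h0 (hh' x).1.le]⟩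
    · refine ⟨1 + C * t, by linarith, fun x => ?_⟩
      nlinarith [mul_le_mul_of_nonpos_left (hh' x).2 h0]
  have hder : ∀ x, HasDerivAt (fun x : ℝ => x + t * h x - c * x)
      (1 + t * deriv h x - c * 1) x := fun x =>
    ((hasDerivAt_id x).add ((hd x).hasDerivAt.const_mul t)).sub ((hasDerivAt_id x).const_mul c)
  have hm : Monotone (fun x : ℝ => x + t * h x - c * x) :=
    monotone_of_deriv_nonneg (fun x => (hder x).differentiableAt)
      (fun x => by rw [(hder x).deriv]; linarith [hct x])
  have key : ∀ x y : ℝ, x ≤ y → c * (y - x) ≤ (y + t * h y) - (x + t * h x) := by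
    intro x y hxy
    have := hm hxy
    simp only at this
    linarith
  constructor
  · intro x y hxy
    simp only at hxy
    rcases le_total x y with h1 | h1
    · have := key x y h1
      nlinarith
    · have := key y x h1
      nlinarith
  · have hcont : Continuous (fun x : ℝ => x + t * h x) :=
      continuous_id.add (continuous_const.mul hd.continuous)
    refine hcont.surjective ?_ ?_
    · refine Filter.tendsto_atTop_mono' _ (f₁ := fun x => c * x + (0 + t * h 0)) ?_ ?_
      · filter_upwards [Filter.eventually_ge_atTop (0:ℝ)] with x hx
        have := key 0 x hx
        linarith
      · exact Filter.tendsto_atTop_add_const_right _ _ (Filter.tendsto_id.const_mul_atTop hc)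
    · refine Filter.tendsto_atBot_mono' _ (f₁ := fun x => c * x + (0 + t * h 0)) ?_ ?_
      · filter_upwards [Filter.eventually_le_atBot (0:ℝ)] with x hx
        have := key x 0 hx
        linarith
      · exact Filter.tendsto_atBot_add_const_right _ _ (Filter.tendsto_id.const_mul_atBot hc)

lemma tri_bij (h : ℝ → ℝ) : ∀ (M : ℕ) (T : Matrix (Fin M) (Fin M) ℝ)
    (_ : ∀ i j : Fin M, j < i → T i j = 0)
    (_ : ∀ i, Function.Bijective (fun x : ℝ => x + T i i * h x)),
    Function.Bijective (fun u : Fin M → ℝ => u + T.mulVec (fun m => h (u m))) := by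
  intro M
  induction M with
  | zero =>
    intro T _ _
    exact ⟨fun a b _ => Subsingleton.elim _ _, fun y => ⟨y, Subsingleton.elim _ _⟩⟩
  | succ n ih =>
    intro T hT hb
    have ih' := ih (fun i j => T i.succ j.succ)
      (fun i j hij => hT _ _ (Fin.succ_lt_succ_iff.mpr hij)) (fun i => hb i.succ)
    have e0 : ∀ u : Fin (n+1) → ℝ, (u + T.mulVec (fun m => h (u m))) 0
        = (u 0 + T 0 0 * h (u 0)) + ∑ j : Fin n, T 0 j.succ * h (u j.succ) := by
      intro u
      simp [Matrix.mulVec, dotProduct, Fin.sum_univ_succ, add_assoc]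
    have es : ∀ (u : Fin (n+1) → ℝ) (i : Fin n), (u + T.mulVec (fun m => h (u m))) i.succ
        = ((fun j : Fin n => u j.succ) + Matrix.mulVec (fun i j : Fin n => T i.succ j.succ)
            (fun m => h (u m.succ))) i := by
      intro u i
      simp [Matrix.mulVec, dotProduct, Fin.sum_univ_succ, hT i.succ 0 (Fin.succ_pos i)]
    constructor
    · intro u v huv
      simp only at huv
      have h1 : (fun j : Fin n => u j.succ) = fun j : Fin n => v j.succ := by
        apply ih'.1
        funext i
        have := congrFun huv i.succ
        rw [es, es] at this
        exact this
      have h1' : ∀ j : Fin n, u j.succ = v j.succ := fun j => congrFun h1 j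
      have h0 : u 0 = v 0 := by
        apply (hb 0).1
        have := congrFun huv 0
        rw [e0, e0] at this
        simp only [h1'] at this
        exact add_right_cancel this
      funext i
      refine Fin.cases h0 h1' i
    · intro y
      obtain ⟨w, hw⟩ := ih'.2 (fun j => y j.succ)
      obtain ⟨x, hx⟩ := (hb 0).2 (y 0 - ∑ j : Fin n, T 0 j.succ * h (w j))
      refine ⟨Fin.cons x w, ?_⟩
      funext i
      refine Fin.cases ?_ (fun i => ?_) i
      · simp only [e0, Fin.cons_zero, Fin.cons_succ]
        simp only at hx
        linarith
      · simp only [es, Fin.cons_succ]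
        exact congrFun hw i


/-- Invertibility of Sylvester normalizing flows (general triangular case):
if `M ≤ D`, `Q` has orthonormal columns, `R` and `R̃` are upper triangular
with `R̃` invertible, `h` is `C¹` with `0 < h' ≤ C`, and the diagonal entries
satisfy `C * R i i * R̃ i i > -1`, then
`φ(z) = z + Q R h(R̃ Qᵀ z + b)` is a bijection of `ℝ^D`. -/
theorem sylvester_flow_invertible (D M : ℕ) (hMD : M ≤ D)
    (Q : Matrix (Fin D) (Fin M) ℝ) (hQ : Qᵀ * Q = 1)
    (R Rt : Matrix (Fin M) (Fin M) ℝ)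
    (hR : ∀ i j : Fin M, j < i → R i j = 0)
    (hRt : ∀ i j : Fin M, j < i → Rt i j = 0)
    (hRtInv : IsUnit Rt)
    (b : Fin M → ℝ) (h : ℝ → ℝ) (C : ℝ) (hC : 0 < C)
    (hh : ContDiff ℝ 1 h)
    (hh' : ∀ x : ℝ, 0 < deriv h x ∧ deriv h x ≤ C)
    (hdiag : ∀ i : Fin M, C * R i i * Rt i i > -1) :
    Function.Bijective (fun z : Fin D → ℝ =>
      z + Q.mulVec (R.mulVec (fun m => h ((Rt.mulVec (Qᵀ.mulVec z) + b) m)))) := by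
  have hbij := tri_bij h M (Rt * R)
    (fun i j hij => by
      rw [Matrix.mul_apply]
      refine Finset.sum_eq_zero fun k _ => ?_
      rcases lt_or_ge k i with hk | hk
      · rw [hRt i k hk, zero_mul]
      · rw [hR k j (lt_of_lt_of_le hij hk), mul_zero])
    (fun i => by
      have hii : (Rt * R) i i = R i i * Rt i i := by
        rw [Matrix.mul_apply, Finset.sum_eq_single i]
        · ring
        · intro k _ hk
          rcases lt_or_gt_of_ne hk with hk | hk
          · rw [hRt i k hk, zero_mul]
          · rw [hR k i hk, mul_zero]
        · simp
      rw [hii]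
      exact scalar_bij h C _ hh hh' (by rw [← mul_assoc]; exact hdiag i))
  have hAB : ∀ w : Fin M → ℝ,
      Rt.mulVec (Qᵀ.mulVec (Q.mulVec (R.mulVec w))) = (Rt * R).mulVec w := by
    intro w
    rw [Matrix.mulVec_mulVec (M := Qᵀ), hQ, Matrix.one_mulVec, Matrix.mulVec_mulVec]
  constructor
  · intro z z' hz
    simp only at hz
    have hu : Rt.mulVec (Qᵀ.mulVec z) + b = Rt.mulVec (Qᵀ.mulVec z') + b := by
      apply hbij.1
      have := congrArg (fun z => Rt.mulVec (Qᵀ.mulVec z) + b) hz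
      simp only [Matrix.mulVec_add, hAB] at this
      simp only
      rw [add_right_comm, this, add_right_comm]
    rw [hu] at hz
    exact add_right_cancel hz
  · intro y
    obtain ⟨u, hu⟩ := hbij.2 (Rt.mulVec (Qᵀ.mulVec y) + b)
    refine ⟨y - Q.mulVec (R.mulVec (fun m => h (u m))), ?_⟩
    have : Rt.mulVec (Qᵀ.mulVec (y - Q.mulVec (R.mulVec (fun m => h (u m))))) + b = u := by
      rw [Matrix.mulVec_sub, Matrix.mulVec_sub, hAB, sub_add_eq_add_sub, ← hu]
      simp
    simp only [this]
    simp
end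

section
/- Invertibility of Sylvester flows with triangular R and diagonal R̃: let M ≤ D, let Q be a real D×M matrix with orthonormal columns (Qᵀ Q = I_M), let R be an M×M upper triangular real matrix, let R̃ be an M×M diagonal real matrix, let b ∈ ℝ^M, and let h : ℝ → ℝ be continuously differentiable with derivative h' satisfying 0 < h'(x) ≤ C for all x ∈ ℝ and some constant C > 0. If C · R_{ii} · R̃_{ii} > -1 for all i = 1,…,M, then the map φ(z) = z + Q R h(R̃ Qᵀ z + b) (h applied componentwise) is a bijection of ℝ^D. -/
open Matrix

lemma aux_scalar (h : ℝ → ℝ) (C r s b : ℝ) (hh : ContDiff ℝ 1 h)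
    (hh' : ∀ x : ℝ, 0 < deriv h x ∧ deriv h x ≤ C) (hd : C * r * s > -1) :
    Function.Bijective (fun t : ℝ => t + r * h (s * t + b)) := by
  obtain ⟨ε, hε, hb⟩ : ∃ ε : ℝ, 0 < ε ∧ ∀ x, ε ≤ 1 + r * (deriv h x * s) := by
    refine ⟨min 1 (1 + C * r * s), lt_min one_pos (by linarith), fun x => ?_⟩
    obtain ⟨h1, h2⟩ := hh' x
    rcases le_total 0 (r * s) with hp | hp
    · exact (min_le_left _ _).trans (by nlinarith)
    · exact (min_le_right _ _).trans (by nlinarith)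
  have hdiff : Differentiable ℝ h := hh.differentiable (by norm_num)
  have hder : ∀ t, HasDerivAt (fun t : ℝ => t + r * h (s * t + b) - ε * t)
      (1 + r * (deriv h (s * t + b) * s) - ε) t := by
    intro t
    have h1 : HasDerivAt (fun t : ℝ => s * t + b) s t := by
      simpa using ((hasDerivAt_id t).const_mul s).add_const b
    have h2 := (hdiff (s * t + b)).hasDerivAt.comp t h1
    have h3 : HasDerivAt (fun t : ℝ => ε * t) ε t := by
      simpa using (hasDerivAt_id t).const_mul ε
    exact ((hasDerivAt_id t).add (h2.const_mul r)).sub h3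
  have hm : Monotone (fun t : ℝ => t + r * h (s * t + b) - ε * t) := by
    apply monotone_of_deriv_nonneg (fun t => (hder t).differentiableAt)
    intro t
    rw [(hder t).deriv]
    linarith [hb (s * t + b)]
  have hcont : Continuous (fun t : ℝ => t + r * h (s * t + b)) := by
    have := hh.continuous
    fun_prop
  constructor
  · apply StrictMono.injective
    intro x y hxy
    have := hm hxy.le
    have h2 := mul_lt_mul_of_pos_left hxy hε
    simp only at this ⊢
    linarith
  · apply hcont.surjective
    · apply Filter.tendsto_atTop_mono' _ (f₁ := fun t : ℝ => ε * t + (r * h (s * 0 + b)))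
      · filter_upwards [Filter.eventually_ge_atTop 0] with t ht
        have := hm ht
        simp only at this
        linarith
      · exact Filter.tendsto_atTop_add_const_right _ _
          (Filter.Tendsto.const_mul_atTop hε Filter.tendsto_id)
    · apply Filter.tendsto_atBot_mono' _ (f₁ := fun t : ℝ => ε * t + (r * h (s * 0 + b)))
      · filter_upwards [Filter.eventually_le_atBot 0] with t ht
        have := hm ht
        simp only at this
        linarith
      · exact Filter.tendsto_atBot_add_const_right _ _
          (Filter.Tendsto.const_mul_atBot hε Filter.tendsto_id)

lemma aux_tri (M : ℕ) (f : Fin M → ℝ → ℝ) (hf : ∀ i, Function.Bijective (f i))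
    (G : (Fin M → ℝ) → Fin M → ℝ)
    (hG : ∀ i y y', (∀ j, i < j → y j = y' j) → G y i = G y' i) :
    Function.Bijective (fun (y : Fin M → ℝ) (i : Fin M) => f i (y i) + G y i) := by
  constructor
  · intro y y' hy
    have key : ∀ k : ℕ, ∀ i : Fin M, M ≤ i.val + k → y i = y' i := by
      intro k
      induction k with
      | zero => intro i hi; have := i.2; omega
      | succ k ih =>
        intro i hi
        have e := congrFun hy i
        simp only at e
        rw [hG i y y' (fun j hj => ih j (by have : i.val < j.val := hj; omega))] at e
        exact (hf i).1 (add_right_cancel e)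
    ext i
    exact key M i (by omega)
  · intro w
    have key : ∀ k : ℕ, ∃ y : Fin M → ℝ, ∀ i : Fin M, M ≤ i.val + k →
        f i (y i) + G y i = w i := by
      intro k
      induction k with
      | zero => exact ⟨0, fun i hi => by have := i.2; omega⟩
      | succ k ih =>
        obtain ⟨y, hy⟩ := ih
        by_cases hk : k < M
        · obtain ⟨t, ht⟩ := (hf ⟨M - (k + 1), by omega⟩).2
            (w ⟨M - (k + 1), by omega⟩ - G y ⟨M - (k + 1), by omega⟩)
          set m : Fin M := ⟨M - (k + 1), by omega⟩ with hm
          have hmv : m.val = M - (k + 1) := rfl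
          refine ⟨Function.update y m t, fun i hi => ?_⟩
          have hu : G (Function.update y m t) i = G y i := by
            apply hG
            intro j hj
            have : i.val < j.val := hj
            rw [Function.update_of_ne]
            intro e
            rw [e] at this
            omega
          rw [hu]
          by_cases him : i = m
          · rw [him, Function.update_self, ht]; ring
          · rw [Function.update_of_ne him]
            apply hy
            have : i.val ≠ m.val := fun e => him (Fin.ext e)
            omega
        · exact ⟨y, fun i hi => hy i (by omega)⟩
    obtain ⟨y, hy⟩ := key M
    exact ⟨y, funext fun i => hy i (by omega)⟩


/-- Invertibility of Sylvester flows with upper triangular `R` and diagonal `R̃`: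
if `M ≤ D`, `Q` has orthonormal columns, `h` is `C¹` with `0 < h' ≤ C`, and
`C * R i i * R̃ i i > -1` for all `i`, then
`φ(z) = z + Q R h(R̃ Qᵀ z + b)` is a bijection of `ℝ^D`. -/
theorem sylvester_flow_invertible_triangular_diagonal (D M : ℕ) (hMD : M ≤ D)
    (Q : Matrix (Fin D) (Fin M) ℝ) (hQ : Qᵀ * Q = 1)
    (R Rt : Matrix (Fin M) (Fin M) ℝ)
    (hR : ∀ i j : Fin M, j < i → R i j = 0)
    (hRt : ∀ i j : Fin M, i ≠ j → Rt i j = 0)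
    (b : Fin M → ℝ) (h : ℝ → ℝ) (C : ℝ) (hC : 0 < C)
    (hh : ContDiff ℝ 1 h)
    (hh' : ∀ x : ℝ, 0 < deriv h x ∧ deriv h x ≤ C)
    (hdiag : ∀ i : Fin M, C * R i i * Rt i i > -1) :
    Function.Bijective (fun z : Fin D → ℝ =>
      z + Q.mulVec (R.mulVec (fun m => h ((Rt.mulVec (Qᵀ.mulVec z) + b) m)))) := by
  have hRt' : ∀ (y : Fin M → ℝ) m, (Rt.mulVec y + b) m = Rt m m * y m + b m := by
    intro y m
    rw [Pi.add_apply, Matrix.mulVec, dotProduct, Finset.sum_eq_single m]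
    · intro j _ hj
      rw [hRt m j hj.symm, zero_mul]
    · simp
  have hψ : Function.Bijective (fun y : Fin M → ℝ =>
      y + R.mulVec (fun m => h ((Rt.mulVec y + b) m))) := by
    have := aux_tri M (fun i t => t + R i i * h (Rt i i * t + b i))
      (fun i => aux_scalar h C _ _ _ hh hh' (hdiag i))
      (fun y i => ∑ j ∈ Finset.univ.erase i, R i j * h (Rt j j * y j + b j)) ?_
    · convert this using 1
      funext y i
      simp only [hRt']
      rw [Pi.add_apply, Matrix.mulVec, dotProduct,
        ← Finset.add_sum_erase _ _ (Finset.mem_univ i), add_assoc]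
    · intro i y y' hy
      apply Finset.sum_congr rfl
      intro j hj
      rcases lt_or_gt_of_ne (Finset.ne_of_mem_erase hj) with hl | hl
      · rw [hR i j hl]; ring
      · rw [hy j hl]
  have hQQ : ∀ v : Fin M → ℝ, Qᵀ.mulVec (Q.mulVec v) = v := by
    intro v
    rw [Matrix.mulVec_mulVec, hQ, Matrix.one_mulVec]
  constructor
  · intro z z' hz
    simp only at hz
    have e : Qᵀ.mulVec z = Qᵀ.mulVec z' := by
      apply hψ.1
      have := congrArg (Qᵀ.mulVec) hz
      simpa only [Matrix.mulVec_add, hQQ] using this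
    rw [e] at hz
    exact add_right_cancel hz
  · intro w
    obtain ⟨y, hy⟩ := hψ.2 (Qᵀ.mulVec w)
    simp only at hy
    refine ⟨w - Q.mulVec (R.mulVec (fun m => h ((Rt.mulVec y + b) m))), ?_⟩
    have e : Qᵀ.mulVec (w - Q.mulVec (R.mulVec (fun m => h ((Rt.mulVec y + b) m)))) = y := by
      rw [Matrix.mulVec_sub, hQQ, ← hy, add_sub_cancel_right]
    simp only [e, sub_add_cancel]
end

section
/- Jacobian determinant of a Sylvester flow: let M ≤ D, let Q be a real D×M matrix with orthonormal columns (Qᵀ Q = I_M), let R and R̃ be M×M upper triangular real matrices, let b ∈ ℝ^M, and let h : ℝ → ℝ be differentiable. Then the Jacobian determinant of φ(z) = z + Q R h(R̃ Qᵀ z + b) (h applied componentwise) at any z ∈ ℝ^D equals det(I_M + diag(h'(R̃ Qᵀ z + b)) · R̃ · R) = ∏_{i=1}^M (1 + h'((R̃ Qᵀ z + b)_i) · R̃_{ii} · R_{ii}), since R̃ R is upper triangular. -/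
open Matrix

/-- Jacobian determinant of a Sylvester flow `φ(z) = z + Q R h(R̃ Qᵀ z + b)`:
`φ` is differentiable at every `z` with Jacobian matrix
`I_D + (Q R) * diag(h'(R̃ Qᵀ z + b)) * (R̃ Qᵀ)`, whose determinant equals
`det (I_M + diag(h'(R̃ Qᵀ z + b)) * R̃ * R)`, which in turn equals
`∏ i, (1 + h'((R̃ Qᵀ z + b)_i) * R̃_{ii} * R_{ii})` since `R̃ R` is upper
triangular. -/
theorem sylvester_flow_jacobian_det (D M : ℕ) (hMD : M ≤ D)
    (Q : Matrix (Fin D) (Fin M) ℝ) (hQ : Qᵀ * Q = 1)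
    (R Rt : Matrix (Fin M) (Fin M) ℝ)
    (hR : ∀ i j : Fin M, j < i → R i j = 0)
    (hRt : ∀ i j : Fin M, j < i → Rt i j = 0)
    (b : Fin M → ℝ) (h : ℝ → ℝ) (hh : Differentiable ℝ h) (z : Fin D → ℝ) :
    HasFDerivAt
      (fun z : Fin D → ℝ =>
        z + Q.mulVec (R.mulVec (fun m => h (((Rt * Qᵀ).mulVec z + b) m))))
      (LinearMap.toContinuousLinearMap
        ((1 + (Q * R) * Matrix.diagonal (fun m => deriv h (((Rt * Qᵀ).mulVec z + b) m))
            * (Rt * Qᵀ)).mulVecLin)) z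
    ∧ ((1 : Matrix (Fin D) (Fin D) ℝ)
        + (Q * R) * Matrix.diagonal (fun m => deriv h (((Rt * Qᵀ).mulVec z + b) m))
          * (Rt * Qᵀ)).det
      = ((1 : Matrix (Fin M) (Fin M) ℝ)
          + Matrix.diagonal (fun m => deriv h (((Rt * Qᵀ).mulVec z + b) m)) * (Rt * R)).det
    ∧ ((1 : Matrix (Fin M) (Fin M) ℝ)
          + Matrix.diagonal (fun m => deriv h (((Rt * Qᵀ).mulVec z + b) m)) * (Rt * R)).det
      = ∏ i : Fin M, (1 + deriv h (((Rt * Qᵀ).mulVec z + b) i) * Rt i i * R i i) := by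
  have hlin : ∀ {m n : ℕ} (A : Matrix (Fin m) (Fin n) ℝ) (x : Fin n → ℝ),
      HasFDerivAt (fun y => A.mulVec y) (LinearMap.toContinuousLinearMap A.mulVecLin) x :=
    fun A x => (LinearMap.toContinuousLinearMap A.mulVecLin).hasFDerivAt
  refine ⟨?_, ?_, ?_⟩
  · have h1 : HasFDerivAt (fun z : Fin D → ℝ => (Rt * Qᵀ).mulVec z + b)
        (LinearMap.toContinuousLinearMap (Rt * Qᵀ).mulVecLin) z := (hlin _ z).add_const b
    have h2 : HasFDerivAt (fun z : Fin D → ℝ => fun m => h (((Rt * Qᵀ).mulVec z + b) m))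
        ((LinearMap.toContinuousLinearMap (Matrix.diagonal
          (fun m => deriv h (((Rt * Qᵀ).mulVec z + b) m))).mulVecLin).comp
          (LinearMap.toContinuousLinearMap (Rt * Qᵀ).mulVecLin)) z := by
      apply hasFDerivAt_pi''
      intro m
      have h3 := (hasFDerivAt_pi'.1 h1) m
      have h4 := (hh (((Rt * Qᵀ).mulVec z + b) m)).hasDerivAt.comp_hasFDerivAt z h3
      refine h4.congr_fderiv ?_
      apply ContinuousLinearMap.ext
      intro v
      exact (Matrix.mulVec_diagonal (fun m => deriv h (((Rt * Qᵀ).mulVec z + b) m)) ((Rt * Qᵀ).mulVec v) m).symm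
    have h5 := (hasFDerivAt_id z).add ((hlin Q _).comp z ((hlin R _).comp z h2))
    refine h5.congr_fderiv ?_
    apply ContinuousLinearMap.ext
    intro v
    simp [Matrix.add_mulVec, Matrix.mulVec_mulVec, Matrix.mul_assoc]
  · rw [Matrix.mul_assoc, Matrix.det_one_add_mul_comm]
    congr 2
    calc _ = Matrix.diagonal (fun m => deriv h (((Rt * Qᵀ).mulVec z + b) m)) *
          (Rt * ((Qᵀ * Q) * R)) := by simp only [Matrix.mul_assoc]
      _ = _ := by rw [hQ, Matrix.one_mul]
  · have hz : ∀ i j : Fin M, j < i → (Rt * R) i j = 0 := by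
      intro i j hij
      rw [Matrix.mul_apply]
      refine Finset.sum_eq_zero fun k _ => ?_
      rcases lt_or_ge k i with hk | hk
      · rw [hRt i k hk, zero_mul]
      · rw [hR k j (lt_of_lt_of_le hij hk), mul_zero]
    have hd : ∀ i : Fin M, (Rt * R) i i = Rt i i * R i i := by
      intro i
      rw [Matrix.mul_apply]
      refine Finset.sum_eq_single i (fun k _ hki => ?_) (by simp)
      rcases lt_or_gt_of_ne hki with hk | hk
      · rw [hRt i k hk, zero_mul]
      · rw [hR k i hk, mul_zero]
    rw [Matrix.det_of_isUpperTriangular]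
    · refine Finset.prod_congr rfl fun i _ => ?_
      rw [Matrix.add_apply, Matrix.diagonal_mul, hd, Matrix.one_apply_eq, mul_assoc]
    · intro i j hij
      have hij' : j < i := hij
      rw [Matrix.add_apply, Matrix.diagonal_mul, hz i j hij', Matrix.one_apply_ne hij'.ne']
      simp
end

section
/- Jacobian determinant of a planar flow: let u, w ∈ ℝ^D, b ∈ ℝ, and let h : ℝ → ℝ be differentiable. Then the map F(z) = z + u · h(wᵀz + b) is differentiable at every z ∈ ℝ^D with Jacobian matrix I_D + h'(wᵀz + b) · u wᵀ, and its Jacobian determinant equals 1 + h'(wᵀz + b) · (uᵀw). -/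
open Matrix

/-- Jacobian determinant of a planar flow `F(z) = z + u * h(wᵀz + b)`:
`F` is differentiable at every `z` with Jacobian matrix
`I_D + h'(wᵀz + b) • (u wᵀ)` (outer product), and its determinant equals
`1 + h'(wᵀz + b) * (uᵀw)` by the matrix determinant lemma. -/
theorem planar_flow_jacobian (D : ℕ) (u w : Fin D → ℝ) (b : ℝ)
    (h : ℝ → ℝ) (hh : Differentiable ℝ h) (z : Fin D → ℝ) :
    HasFDerivAt (fun z : Fin D → ℝ => z + h (w ⬝ᵥ z + b) • u)
      (LinearMap.toContinuousLinearMap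
        ((1 + deriv h (w ⬝ᵥ z + b) • Matrix.vecMulVec u w).mulVecLin)) z
    ∧ ((1 : Matrix (Fin D) (Fin D) ℝ)
        + deriv h (w ⬝ᵥ z + b) • Matrix.vecMulVec u w).det
      = 1 + deriv h (w ⬝ᵥ z + b) * (u ⬝ᵥ w) := by
  constructor
  · let L : (Fin D → ℝ) →L[ℝ] ℝ :=
      LinearMap.toContinuousLinearMap (dotProductBilin ℝ ℝ w)
    have h1 : HasFDerivAt (fun z : Fin D → ℝ => w ⬝ᵥ z + b) L z :=
      (L.hasFDerivAt (x := z)).add_const b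
    have h2 := (hh (w ⬝ᵥ z + b)).hasDerivAt.comp_hasFDerivAt z h1
    have h3 := (hasFDerivAt_id z).add (h2.smul_const u)
    refine h3.congr_fderiv ?_
    refine ContinuousLinearMap.ext fun v => ?_
    have hL : L v = w ⬝ᵥ v := rfl
    ext i
    simp [hL, Matrix.add_mulVec, Matrix.smul_mulVec, Matrix.vecMulVec_mulVec]
    ring
  · have key := Matrix.det_one_add_replicateCol_mul_replicateRow (ι := Unit)
      (deriv h (w ⬝ᵥ z + b) • u) w
    rw [← Matrix.vecMulVec_eq, Matrix.smul_vecMulVec, dotProduct_smul, smul_eq_mul,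
      dotProduct_comm w u] at key
    exact key
end

section
/- Invertibility of planar flows with tanh nonlinearity: let u, w ∈ ℝ^D and b ∈ ℝ with uᵀw ≥ -1. Then the map F : ℝ^D → ℝ^D given by F(z) = z + u · tanh(wᵀz + b) is a bijection of ℝ^D. -/
open Matrix

lemma pf_sinh_lt (t : ℝ) (ht : 0 < t) : Real.sinh t < t * Real.cosh t := by
  have hd : ∀ x : ℝ, HasDerivAt (fun x : ℝ => x * Real.cosh x - Real.sinh x)
      (x * Real.sinh x) x := by
    intro x
    have h := ((hasDerivAt_id x).mul (Real.hasDerivAt_cosh x)).sub (Real.hasDerivAt_sinh x)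
    refine h.congr_deriv ?_
    simp
  have hm : StrictMonoOn (fun x : ℝ => x * Real.cosh x - Real.sinh x) (Set.Ici 0) := by
    apply strictMonoOn_of_deriv_pos (convex_Ici 0)
    · exact fun x _ => (hd x).continuousAt.continuousWithinAt
    · intro x hx
      rw [interior_Ici] at hx
      rw [(hd x).deriv]
      exact mul_pos hx (Real.sinh_pos_iff.2 hx)
  have := hm (Set.mem_Ici.2 le_rfl) (Set.mem_Ici.2 ht.le) ht
  simp at this
  exact this

lemma pf_tanh_sub (x y : ℝ) (h : x < y) :
    0 < Real.tanh y - Real.tanh x ∧ Real.tanh y - Real.tanh x < y - x := by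
  have hx := Real.cosh_pos x
  have hy := Real.cosh_pos y
  have e : Real.tanh y - Real.tanh x = Real.sinh (y - x) / (Real.cosh x * Real.cosh y) := by
    rw [Real.tanh_eq_sinh_div_cosh, Real.tanh_eq_sinh_div_cosh, Real.sinh_sub]
    field_simp
  have hxy := mul_pos hx hy
  rw [e]
  refine ⟨div_pos (Real.sinh_pos_iff.2 (sub_pos.2 h)) hxy, ?_⟩
  rw [div_lt_iff₀ hxy]
  obtain ⟨t, ht⟩ : ∃ t, t = (y - x) / 2 := ⟨_, rfl⟩
  have hyx : y - x = 2 * t := by linarith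
  have ht0 : 0 < t := by linarith
  have h1 := pf_sinh_lt t ht0
  have hc := Real.cosh_pos t
  have h2 : Real.cosh t ^ 2 ≤ Real.cosh x * Real.cosh y := by
    have a := Real.cosh_add y x
    have b := Real.cosh_sub y x
    have c := Real.one_le_cosh (y + x)
    rw [hyx, Real.cosh_two_mul] at b
    have d := Real.cosh_sq t
    nlinarith
  rw [hyx, Real.sinh_two_mul]
  nlinarith [mul_lt_mul_of_pos_right h1 hc, mul_le_mul_of_nonneg_left h2 ht0.le]

lemma pf_tanh_cont : Continuous Real.tanh := by
  have : Real.tanh = fun x => Real.sinh x / Real.cosh x :=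
    funext Real.tanh_eq_sinh_div_cosh
  rw [this]
  exact Real.continuous_sinh.div Real.continuous_cosh fun x => (Real.cosh_pos x).ne'

lemma pf_mono (c b : ℝ) (hc : -1 ≤ c) :
    StrictMono (fun s : ℝ => s + c * Real.tanh (s + b)) := by
  intro x y h
  obtain ⟨h1, h2⟩ := pf_tanh_sub (x + b) (y + b) (by linarith)
  show x + c * Real.tanh (x + b) < y + c * Real.tanh (y + b)
  nlinarith

lemma pf_surj (c b : ℝ) :
    Function.Surjective (fun s : ℝ => s + c * Real.tanh (s + b)) := by
  intro a
  have hb : ∀ s, |c * Real.tanh s| ≤ |c| := by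
    intro s
    rw [abs_mul]
    exact mul_le_of_le_one_right (abs_nonneg c)
      (abs_le.2 ⟨(Real.neg_one_lt_tanh s).le, (Real.tanh_lt_one s).le⟩)
  have hcont : Continuous (fun s : ℝ => s + c * Real.tanh (s + b)) :=
    continuous_id.add (continuous_const.mul (pf_tanh_cont.comp (continuous_id.add continuous_const)))
  apply mem_range_of_exists_le_of_exists_ge hcont
  · exact ⟨a - |c|, by linarith [(abs_le.1 (hb (a - |c| + b))).2]⟩
  · exact ⟨a + |c|, by linarith [(abs_le.1 (hb (a + |c| + b))).1]⟩

/-- Invertibility of planar flows with `tanh` nonlinearity: if `uᵀw ≥ -1`,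
then `F(z) = z + u * tanh(wᵀz + b)` is a bijection of `ℝ^D`. -/
theorem planar_flow_tanh_bijective (D : ℕ) (u w : Fin D → ℝ) (b : ℝ)
    (huw : u ⬝ᵥ w ≥ -1) :
    Function.Bijective (fun z : Fin D → ℝ => z + Real.tanh (w ⬝ᵥ z + b) • u) := by
  rw [dotProduct_comm] at huw
  constructor
  · intro z1 z2 h
    have h' : z1 + Real.tanh (w ⬝ᵥ z1 + b) • u = z2 + Real.tanh (w ⬝ᵥ z2 + b) • u := h
    have e := congrArg (fun z => w ⬝ᵥ z) h'
    simp only [dotProduct_add, dotProduct_smul, smul_eq_mul] at e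
    have hs : w ⬝ᵥ z1 = w ⬝ᵥ z2 := by
      apply (pf_mono (w ⬝ᵥ u) b huw).injective
      show _ + _ = _ + _
      linarith
    rw [hs] at h'
    exact add_right_cancel h'
  · intro y
    obtain ⟨s, hs⟩ := pf_surj (w ⬝ᵥ u) b (w ⬝ᵥ y)
    have hs' : s + w ⬝ᵥ u * Real.tanh (s + b) = w ⬝ᵥ y := hs
    refine ⟨y - Real.tanh (s + b) • u, ?_⟩
    have : w ⬝ᵥ (y - Real.tanh (s + b) • u) = s := by
      rw [dotProduct_sub, dotProduct_smul, smul_eq_mul]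
      linarith
    show _ + _ = y
    rw [this]
    exact sub_add_cancel _ _
end

section
/- One step of the Björck–Bowie orthogonalization iteration: let Q be a real D×M matrix, set E = I_M - Qᵀ Q and Q' = Q (I_M + (1/2) E). Then I_M - Q'ᵀ Q' = (3/4) E² + (1/4) E³. Consequently, for any submultiplicative matrix norm, ‖I_M - Q'ᵀQ'‖ ≤ (3/4)‖E‖² + (1/4)‖E‖³, and in particular ‖I_M - Q'ᵀQ'‖ < ‖E‖² whenever 0 < ‖E‖ < 1. -/
open Matrix

/-- One step of the Björck–Bowie orthogonalization iteration: with
`E = I - QᵀQ` and `Q' = Q (I + ½E)`, one has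
`I - Q'ᵀQ' = ¾ E² + ¼ E³`; consequently, for any submultiplicative matrix
norm `N`, `N (I - Q'ᵀQ') ≤ ¾ (N E)² + ¼ (N E)³`, and in particular
`N (I - Q'ᵀQ') < (N E)²` whenever `0 < N E < 1`. -/
theorem bjorck_bowie_step (D M : ℕ) (Q : Matrix (Fin D) (Fin M) ℝ)
    (N : Matrix (Fin M) (Fin M) ℝ → ℝ)
    (hN_add : ∀ A B : Matrix (Fin M) (Fin M) ℝ, N (A + B) ≤ N A + N B)
    (hN_smul : ∀ (c : ℝ) (A : Matrix (Fin M) (Fin M) ℝ), N (c • A) = |c| * N A)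
    (hN_mul : ∀ A B : Matrix (Fin M) (Fin M) ℝ, N (A * B) ≤ N A * N B) :
    ((1 : Matrix (Fin M) (Fin M) ℝ)
        - (Q * (1 + (1/2 : ℝ) • (1 - Qᵀ * Q)))ᵀ * (Q * (1 + (1/2 : ℝ) • (1 - Qᵀ * Q)))
      = (3/4 : ℝ) • (1 - Qᵀ * Q) ^ 2 + (1/4 : ℝ) • (1 - Qᵀ * Q) ^ 3)
    ∧ N ((1 : Matrix (Fin M) (Fin M) ℝ)
        - (Q * (1 + (1/2 : ℝ) • (1 - Qᵀ * Q)))ᵀ * (Q * (1 + (1/2 : ℝ) • (1 - Qᵀ * Q))))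
      ≤ 3/4 * N (1 - Qᵀ * Q) ^ 2 + 1/4 * N (1 - Qᵀ * Q) ^ 3
    ∧ (0 < N (1 - Qᵀ * Q) → N (1 - Qᵀ * Q) < 1 →
        N ((1 : Matrix (Fin M) (Fin M) ℝ)
          - (Q * (1 + (1/2 : ℝ) • (1 - Qᵀ * Q)))ᵀ * (Q * (1 + (1/2 : ℝ) • (1 - Qᵀ * Q))))
        < N (1 - Qᵀ * Q) ^ 2) := by
  have key : (1 : Matrix (Fin M) (Fin M) ℝ)
        - (Q * (1 + (1/2 : ℝ) • (1 - Qᵀ * Q)))ᵀ * (Q * (1 + (1/2 : ℝ) • (1 - Qᵀ * Q)))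
      = (3/4 : ℝ) • (1 - Qᵀ * Q) ^ 2 + (1/4 : ℝ) • (1 - Qᵀ * Q) ^ 3 := by
    have hT : (Q * (1 + (1/2 : ℝ) • (1 - Qᵀ * Q)))ᵀ * (Q * (1 + (1/2 : ℝ) • (1 - Qᵀ * Q)))
        = (1 + (1/2 : ℝ) • (1 - Qᵀ * Q)) * (Qᵀ * Q) * (1 + (1/2 : ℝ) • (1 - Qᵀ * Q)) := by
      rw [Matrix.transpose_mul]
      simp only [Matrix.transpose_add, Matrix.transpose_smul, Matrix.transpose_sub,
        Matrix.transpose_mul, Matrix.transpose_one, Matrix.transpose_transpose, Matrix.mul_assoc]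
    rw [hT]
    generalize Qᵀ * Q = G
    obtain ⟨E, rfl⟩ : ∃ E, G = 1 - E := ⟨1 - G, by simp⟩
    simp only [sub_sub_cancel, pow_succ, pow_zero, one_mul, add_mul, mul_add, mul_sub, sub_mul,
      mul_one, smul_mul_assoc, mul_smul_comm, smul_add, smul_sub, smul_smul, mul_assoc]
    module
  rw [key]
  generalize (1 : Matrix (Fin M) (Fin M) ℝ) - Qᵀ * Q = E
  have h0 : 0 ≤ N E := by
    have h1 := hN_add E ((-1 : ℝ) • E)
    have h2 := hN_smul 0 E
    have h3 := hN_smul (-1) E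
    have h4 : E + (-1 : ℝ) • E = (0 : ℝ) • E := by module
    rw [h4, h2, h3] at h1
    norm_num at h1
    linarith
  have hs : N (E ^ 2) ≤ N E ^ 2 := by
    rw [pow_two, pow_two]; exact hN_mul E E
  have hc : N (E ^ 3) ≤ N E ^ 3 := by
    rw [pow_succ E 2, pow_succ (N E) 2]
    exact (hN_mul _ _).trans (mul_le_mul_of_nonneg_right hs h0)
  have hb : N ((3/4 : ℝ) • E ^ 2 + (1/4 : ℝ) • E ^ 3) ≤ 3/4 * N E ^ 2 + 1/4 * N E ^ 3 := by
    refine (hN_add _ _).trans ?_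
    rw [hN_smul, hN_smul, abs_of_pos (by norm_num), abs_of_pos (by norm_num)]
    linarith
  refine ⟨rfl, hb, fun hp hl => hb.trans_lt ?_⟩
  have : 0 < N E ^ 2 := by positivity
  nlinarith
end

section
/- Convergence of the Björck–Bowie orthogonalization iteration: let Q^{(0)} be a real D×M matrix with ‖Q^{(0)ᵀ} Q^{(0)} - I_M‖ < 1 in a submultiplicative matrix norm (e.g., the spectral norm), and define the iteration Q^{(k+1)} = Q^{(k)} (I_M + (1/2)(I_M - Q^{(k)ᵀ} Q^{(k)})). Then Q^{(k)ᵀ} Q^{(k)} converges to the identity matrix I_M as k → ∞; in particular ‖I_M - Q^{(k)ᵀ}Q^{(k)}‖ ≤ ‖I_M - Q^{(0)ᵀ}Q^{(0)}‖^{2^k} for all k. -/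
open Matrix Filter

/-- Convergence of the Björck–Bowie orthogonalization iteration
`Q^{(k+1)} = Q^{(k)} (I + ½(I - Q^{(k)ᵀ} Q^{(k)}))`: if in a submultiplicative
matrix norm `N` the initial defect satisfies `N (Q^{(0)ᵀ}Q^{(0)} - I) < 1`,
then `N (I - Q^{(k)ᵀ}Q^{(k)}) ≤ N (I - Q^{(0)ᵀ}Q^{(0)}) ^ (2^k)` for all `k`,
and `Q^{(k)ᵀ} Q^{(k)}` converges to the identity matrix as `k → ∞`. -/
theorem bjorck_bowie_convergence (D M : ℕ)
    (N : Matrix (Fin M) (Fin M) ℝ → ℝ)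
    (hN_add : ∀ A B : Matrix (Fin M) (Fin M) ℝ, N (A + B) ≤ N A + N B)
    (hN_smul : ∀ (c : ℝ) (A : Matrix (Fin M) (Fin M) ℝ), N (c • A) = |c| * N A)
    (hN_mul : ∀ A B : Matrix (Fin M) (Fin M) ℝ, N (A * B) ≤ N A * N B)
    (hN_def : ∀ A : Matrix (Fin M) (Fin M) ℝ, N A = 0 → A = 0)
    (Qs : ℕ → Matrix (Fin D) (Fin M) ℝ)
    (hstep : ∀ k, Qs (k + 1) = Qs k * (1 + (1/2 : ℝ) • (1 - (Qs k)ᵀ * Qs k)))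
    (hinit : N ((Qs 0)ᵀ * Qs 0 - 1) < 1) :
    (∀ k, N (1 - (Qs k)ᵀ * Qs k) ≤ N (1 - (Qs 0)ᵀ * Qs 0) ^ (2 ^ k))
    ∧ Tendsto (fun k => (Qs k)ᵀ * Qs k) atTop (nhds 1) := by
  have h0 : N 0 = 0 := by simpa using hN_smul 0 0
  have hneg : ∀ A, N (-A) = N A := fun A => by simpa using hN_smul (-1) A
  have hnn : ∀ A, 0 ≤ N A := fun A => by
    have h := hN_add A (-A)
    rw [add_neg_cancel, h0, hneg] at h
    linarith
  have hrec : ∀ k, 1 - (Qs (k+1))ᵀ * Qs (k+1) =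
      (3/4 : ℝ) • ((1 - (Qs k)ᵀ * Qs k) * (1 - (Qs k)ᵀ * Qs k)) +
      (1/4 : ℝ) • ((1 - (Qs k)ᵀ * Qs k) * ((1 - (Qs k)ᵀ * Qs k) * (1 - (Qs k)ᵀ * Qs k))) := by
    intro k
    have h1 : (Qs (k+1))ᵀ * Qs (k+1) = (1 + (1/2 : ℝ) • (1 - (Qs k)ᵀ * Qs k)) *
        (((Qs k)ᵀ * Qs k) * (1 + (1/2 : ℝ) • (1 - (Qs k)ᵀ * Qs k))) := by
      rw [hstep k]
      simp only [transpose_mul, transpose_add, transpose_smul, transpose_sub, transpose_one,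
        transpose_transpose, Matrix.mul_assoc]
    rw [h1]
    obtain ⟨E, hE⟩ : ∃ E, E = 1 - (Qs k)ᵀ * Qs k := ⟨_, rfl⟩
    have hS : (Qs k)ᵀ * Qs k = 1 - E := by rw [hE]; abel
    rw [hS, sub_sub_cancel]
    simp only [mul_add, add_mul, mul_sub, sub_mul, mul_one, one_mul, smul_mul_assoc,
      mul_smul_comm]
    module
  have hinit' : N (1 - (Qs 0)ᵀ * Qs 0) < 1 := by
    rw [← hneg, neg_sub]; exact hinit
  have hbound : ∀ k, N (1 - (Qs k)ᵀ * Qs k) ≤ N (1 - (Qs 0)ᵀ * Qs 0) ^ (2 ^ k) := by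
    intro k
    induction k with
    | zero => simp
    | succ k ih =>
      have hle1 : N (1 - (Qs k)ᵀ * Qs k) ≤ 1 :=
        ih.trans (pow_le_one₀ (hnn _) hinit'.le)
      have hsq : N (1 - (Qs (k+1))ᵀ * Qs (k+1)) ≤ N (1 - (Qs k)ᵀ * Qs k) ^ 2 := by
        rw [hrec k]
        generalize 1 - (Qs k)ᵀ * Qs k = E at *
        have a := hN_add ((3/4 : ℝ) • (E * E)) ((1/4 : ℝ) • (E * (E * E)))
        rw [hN_smul, hN_smul, abs_of_pos (by norm_num), abs_of_pos (by norm_num)] at a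
        have b := hN_mul E E
        have c := hN_mul E (E * E)
        have d : N E * N (E * E) ≤ 1 * N (E * E) := mul_le_mul_of_nonneg_right hle1 (hnn _)
        nlinarith
      calc _ ≤ _ := hsq
        _ ≤ (N (1 - (Qs 0)ᵀ * Qs 0) ^ (2 ^ k)) ^ 2 := pow_le_pow_left₀ (hnn _) ih 2
        _ = _ := by rw [← pow_mul, pow_succ]
  refine ⟨hbound, ?_⟩
  have hlim : Tendsto (fun k => N (1 - (Qs k)ᵀ * Qs k)) atTop (nhds 0) := by
    refine squeeze_zero (fun k => hnn _) hbound ?_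
    exact (tendsto_pow_atTop_nhds_zero_of_lt_one (hnn _) hinit').comp
      (tendsto_pow_atTop_atTop_of_one_lt (by norm_num))
  have hE : Tendsto (fun k => 1 - (Qs k)ᵀ * Qs k) atTop (nhds 0) := by
    refine tendsto_pi_nhds.2 fun i => tendsto_pi_nhds.2 fun j => ?_
    have hpos : 0 < N (Matrix.single i j 1) := by
      refine lt_of_le_of_ne (hnn _) fun h => ?_
      have := congrFun (congrFun (hN_def _ h.symm) i) j
      simp at this
    have hent : ∀ A : Matrix (Fin M) (Fin M) ℝ, |A i j| ≤
        (N (Matrix.single i i 1) * N (Matrix.single j j 1) / N (Matrix.single i j 1)) * N A := by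
      intro A
      have h1 : Matrix.single i i 1 * A * Matrix.single j j 1
          = (A i j) • Matrix.single i j (1:ℝ) := by
        rw [Matrix.single_mul_mul_single]
        simp
      have h2 := hN_mul (Matrix.single i i 1 * A) (Matrix.single j j 1)
      rw [h1, hN_smul] at h2
      have h3 := mul_le_mul_of_nonneg_right (hN_mul (Matrix.single i i 1) A)
        (hnn (Matrix.single j j 1))
      rw [div_mul_eq_mul_div, le_div_iff₀ hpos]
      linarith
    refine squeeze_zero_norm (fun k => hent _) ?_
    simpa using hlim.const_mul _
  have := (tendsto_const_nhds (x := (1 : Matrix (Fin M) (Fin M) ℝ))).sub hE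
  simpa using this
end
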